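/- Let λ ∈ (−π/2, π/2), f ∈ F_λ, and β_λ(t, f) = lim_{r→1−} u_f(r e^{it}) + t. Then A(f) = max_{t ∈ ℝ} [ β_λ(t+, f) − β_λ(t−, f) ]; in particular the supremum of the jumps of β_λ(·, f) is attained and equals A(f). -/

import Mathlib

open Set Metric Filter Topology Function

/-- The class `F_λ` of (normalized) `λ`-spirallike functions on the unit disk. -/
def SpiralClass (lam : ℝ) : Set (ℂ → ℂ) :=
  {f | DifferentiableOn ℂ f (ball (0 : ℂ) 1) ∧ f 0 = 0 ∧ deriv f 0 = 1 ∧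
    (∀ z ∈ ball (0 : ℂ) 1, z ≠ 0 → f z ≠ 0) ∧
    ∀ z ∈ ball (0 : ℂ) 1, z ≠ 0 →
      0 < (Complex.exp (-(lam : ℂ) * Complex.I) * z * deriv f z / f z).re}

/-- `L` is the (unique) analytic branch of `log (f z / z)` on the disk vanishing at `0`. -/
def IsLogBranch (f L : ℂ → ℂ) : Prop :=
  DifferentiableOn ℂ L (ball (0 : ℂ) 1) ∧ L 0 = 0 ∧
    ∀ z ∈ ball (0 : ℂ) 1, z ≠ 0 → Complex.exp (L z) = f z / z

/-- The canonical harmonic branch `u_f = Im L_f − (tan λ)·Re L_f` of the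
`λ`-argument of `f(z)/z`. -/
noncomputable def lambdaArgBranch (lam : ℝ) (L : ℂ → ℂ) (z : ℂ) : ℝ :=
  (L z).im - Real.tan lam * (L z).re

/-- `α(R, f)`: the length (in `[0, 2π]`) of the largest open arc `I` of the unit circle
such that `R·ζ ∈ f(𝔻)` for every `ζ ∈ I` (and `0` if there is no such arc). -/
noncomputable def arcLength (f : ℂ → ℂ) (R : ℝ) : ℝ :=
  sSup {a : ℝ | 0 ≤ a ∧ a ≤ 2 * Real.pi ∧ ∃ θ₀ : ℝ, ∀ ψ : ℝ, |ψ - θ₀| < a / 2 →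
    (R : ℂ) * Complex.exp ((ψ : ℂ) * Complex.I) ∈ f '' ball (0 : ℂ) 1}


/-- Left half plane. -/
def LHP : Set ℂ := {z | z.re < 0}

lemma isOpen_LHP : IsOpen LHP := isOpen_lt Complex.continuous_re continuous_const

lemma spiral_mono {G : ℂ → ℂ} (hG : DifferentiableOn ℂ G LHP)
    (hpos : ∀ z ∈ LHP, 0 < (deriv G z).re) {a b : ℂ} (ha : a ∈ LHP) (hb : b ∈ LHP)
    (hab : a ≠ b) :
    0 < (G b - G a).re * (b - a).re + (G b - G a).im * (b - a).im := by
  have hseg : ∀ s ∈ Icc (0:ℝ) 1, a + s * (b - a) ∈ LHP := by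
    intro s hs
    have ha' : a.re < 0 := ha
    have hb' : b.re < 0 := hb
    change (a + s * (b - a)).re < 0
    simp
    rcases hs with ⟨h0, h1⟩
    rcases h0.eq_or_lt with rfl | h0
    · simpa using ha'
    · nlinarith [mul_pos h0 (neg_pos.2 hb'), mul_nonneg (sub_nonneg.2 h1) (neg_pos.2 ha').le]
  have hd : ∀ s ∈ Icc (0:ℝ) 1, HasDerivAt (fun s : ℝ => G (a + s * (b - a)))
      (deriv G (a + s * (b - a)) * (b - a)) s := by
    intro s hs
    have h1 : HasDerivAt G (deriv G (a + s * (b - a))) (a + s * (b - a)) :=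
      (hG.differentiableAt (isOpen_LHP.mem_nhds (hseg s hs))).hasDerivAt
    have h2 : HasDerivAt (fun s : ℝ => a + s * (b - a)) (b - a) s := by
      have := ((Complex.ofRealCLM.hasDerivAt (x := s)).mul_const (b - a)).const_add a
      simpa using this
    exact h1.comp s h2
  have hd2 : ∀ s ∈ Icc (0:ℝ) 1, HasDerivAt
      (fun s : ℝ => (G (a + s * (b - a))).re * (b - a).re + (G (a + s * (b - a))).im * (b - a).im)
      ((deriv G (a + s * (b - a)) * (b - a)).re * (b - a).re
        + (deriv G (a + s * (b - a)) * (b - a)).im * (b - a).im) s := by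
    intro s hs
    have hr := (Complex.reCLM.hasFDerivAt.comp_hasDerivAt s (hd s hs)).mul_const (b - a).re
    have hi := (Complex.imCLM.hasFDerivAt.comp_hasDerivAt s (hd s hs)).mul_const (b - a).im
    exact hr.add hi
  obtain ⟨c, hc, hce⟩ := exists_hasDerivAt_eq_slope _ _ (zero_lt_one' ℝ)
    (fun s hs => (hd2 s hs).continuousAt.continuousWithinAt)
    (fun s hs => hd2 s (Ioo_subset_Icc_self hs))
  have hp := hpos _ (hseg c (Ioo_subset_Icc_self hc))
  have hn : 0 < (b - a).re * (b - a).re + (b - a).im * (b - a).im := by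
    have := Complex.normSq_pos.2 (sub_ne_zero.2 hab.symm)
    simpa [Complex.normSq_apply] using this
  have e : (deriv G (a + c * (b - a)) * (b - a)).re * (b - a).re
        + (deriv G (a + c * (b - a)) * (b - a)).im * (b - a).im
      = (deriv G (a + c * (b - a))).re *
        ((b - a).re * (b - a).re + (b - a).im * (b - a).im) := by
    rw [Complex.mul_re, Complex.mul_im]; ring
  rw [e] at hce
  have h3 := mul_pos hp hn
  rw [hce] at h3
  simp only [Complex.ofReal_one, Complex.ofReal_zero, one_mul, zero_mul, add_zero, sub_zero,
    div_one, add_sub_cancel] at h3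
  simp only [Complex.sub_re, Complex.sub_im] at *
  linarith

lemma mem_LHP {x y : ℝ} (hx : x < 0) : (x + y * Complex.I : ℂ) ∈ LHP := by
  simp [LHP, hx]

lemma spiral_im_lt {G : ℂ → ℂ} (hG : DifferentiableOn ℂ G LHP)
    (hpos : ∀ z ∈ LHP, 0 < (deriv G z).re) {x y₁ y₂ : ℝ} (hx : x < 0) (h : y₁ < y₂) :
    (G (x + y₁ * Complex.I)).im < (G (x + y₂ * Complex.I)).im := by
  have := spiral_mono hG hpos (mem_LHP (y := y₁) hx) (mem_LHP (y := y₂) hx) (by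
    intro e; have := congrArg Complex.im e; simp at this; exact h.ne this)
  simp at this
  nlinarith

lemma spiral_im_le {G : ℂ → ℂ} (hG : DifferentiableOn ℂ G LHP)
    (hpos : ∀ z ∈ LHP, 0 < (deriv G z).re) {x y₁ y₂ : ℝ} (hx : x < 0) (h : y₁ ≤ y₂) :
    (G (x + y₁ * Complex.I)).im ≤ (G (x + y₂ * Complex.I)).im := by
  rcases h.eq_or_lt with rfl | h
  · exact le_rfl
  · exact (spiral_im_lt hG hpos hx h).le

lemma spiral_re_le {G : ℂ → ℂ} (hG : DifferentiableOn ℂ G LHP)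
    (hpos : ∀ z ∈ LHP, 0 < (deriv G z).re) {x₁ x₂ y : ℝ} (hx : x₂ < 0) (h : x₁ ≤ x₂) :
    (G (x₁ + y * Complex.I)).re ≤ (G (x₂ + y * Complex.I)).re := by
  rcases h.eq_or_lt with rfl | h
  · exact le_rfl
  have := spiral_mono hG hpos (mem_LHP (y := y) (h.trans hx)) (mem_LHP (y := y) hx) (by
    intro e; have := congrArg Complex.re e; simp at this; exact h.ne this)
  simp at this
  nlinarith

lemma spiral_open {G : ℂ → ℂ} (hG : DifferentiableOn ℂ G LHP)
    (hpos : ∀ z ∈ LHP, 0 < (deriv G z).re) {U : Set ℂ} (hU : IsOpen U) (hUL : U ⊆ LHP) :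
    IsOpen (G '' U) := by
  rw [isOpen_iff_mem_nhds]
  rintro _ ⟨z, hz, rfl⟩
  have h1 : HasStrictDerivAt G (deriv G z) z :=
    (hG.analyticAt (isOpen_LHP.mem_nhds (hUL hz))).hasStrictDerivAt
  have h2 : deriv G z ≠ 0 := by
    intro e; have := hpos z (hUL hz); simp [e] at this
  rw [← h1.map_nhds_eq h2]
  exact image_mem_map (hU.mem_nhds hz)

lemma spiral_trans {G : ℂ → ℂ} (hG : DifferentiableOn ℂ G LHP)
    (hpos : ∀ z ∈ LHP, 0 < (deriv G z).re)
    (hprop : ∀ x₀ < 0, ∃ C : ℝ, ∀ z : ℂ, z.re ≤ x₀ → ‖z‖ ≤ ‖G z‖ + C)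
    {w : ℂ} (hw : w ∈ G '' LHP) {S : ℝ} (hS : 0 ≤ S) : w - S ∈ G '' LHP := by
  obtain ⟨z₀, hz₀, rfl⟩ := hw
  obtain ⟨C, hC⟩ := hprop z₀.re hz₀
  set K : Set ℂ := {z | z.re ≤ z₀.re} ∩ closedBall 0 (‖G z₀‖ + S + C) with hK
  have hKc : IsCompact K :=
    (isCompact_closedBall _ _).inter_left (isClosed_le Complex.continuous_re continuous_const)
  have hKL : K ⊆ LHP := by
    intro z hz
    have h1 : z.re ≤ z₀.re := hz.1
    have h2 : z₀.re < 0 := hz₀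
    change z.re < 0
    linarith
  have hGK : IsClosed (G '' K) := (hKc.image_of_continuousOn (hG.continuousOn.mono hKL)).isClosed
  set T : Set ℝ := {s | G z₀ - s ∈ G '' LHP} with hT
  have key : T ∩ Icc 0 S = (fun s : ℝ => G z₀ - s) ⁻¹' (G '' K) ∩ Icc 0 S := by
    ext s
    constructor
    · rintro ⟨⟨z, hz, hzs⟩, hs⟩
      refine ⟨⟨z, ?_, hzs⟩, hs⟩
      have hre : z.re ≤ z₀.re := by
        by_contra! hlt
        have := spiral_mono hG hpos hz₀ hz (by rintro rfl; exact lt_irrefl _ hlt)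
        rw [hzs] at this
        simp at this
        nlinarith [hs.1]
      refine ⟨hre, ?_⟩
      rw [mem_closedBall_zero_iff]
      have h1 := hC z hre
      rw [hzs] at h1
      have h2 := norm_sub_le (G z₀) (s : ℂ)
      rw [Complex.norm_real, Real.norm_eq_abs, abs_of_nonneg hs.1] at h2
      linarith [hs.2]
    · rintro ⟨⟨z, hz, hzs⟩, hs⟩
      exact ⟨⟨z, hKL hz, hzs⟩, hs⟩
  have hcont : Continuous (fun s : ℝ => G z₀ - (s : ℂ)) := by fun_prop
  have hsub : Icc 0 S ⊆ T := by
    apply IsClosed.Icc_subset_of_forall_mem_nhdsWithin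
    · rw [key]
      exact (hGK.preimage hcont).inter isClosed_Icc
    · exact ⟨z₀, hz₀, by simp⟩
    · rintro x ⟨hx, -⟩
      apply mem_nhdsWithin_of_mem_nhds
      exact ((spiral_open hG hpos isOpen_LHP le_rfl).preimage hcont).mem_nhds hx
  exact hsub ⟨hS, le_rfl⟩

/-- Cauchy's theorem on a rectangle, imaginary part. -/
lemma rect_im {F : ℂ → ℂ} {a b c d : ℝ} (hab : a ≤ b) (hcd : c ≤ d)
    (hF : ∀ x ∈ Icc a b, ∀ y ∈ Icc c d, DifferentiableAt ℂ F (x + y * Complex.I)) :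
    (∫ y in c..d, (F (b + y * Complex.I)).re) + (∫ x in a..b, (F (x + c * Complex.I)).im)
     = (∫ y in c..d, (F (a + y * Complex.I)).re) + ∫ x in a..b, (F (x + d * Complex.I)).im := by
  have h := Complex.integral_boundary_rect_eq_zero_of_differentiableOn F
    (a + c * Complex.I) (b + d * Complex.I) (by
      intro z hz
      simp only [Complex.mem_reProdIm] at hz
      simp [uIcc_of_le hab, uIcc_of_le hcd] at hz
      have := hF z.re hz.1 z.im hz.2
      rw [Complex.re_add_im] at this
      exact this.differentiableWithinAt)
  simp only [Complex.add_re, Complex.ofReal_re, Complex.mul_re, Complex.I_re, mul_zero,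
    Complex.ofReal_im, Complex.I_im, mul_one, sub_self, add_zero, Complex.add_im, Complex.mul_im,
    zero_add, smul_eq_mul] at h
  have iv : ∀ x ∈ Icc a b, IntervalIntegrable (fun y : ℝ => F (x + y * Complex.I))
      MeasureTheory.volume c d := by
    intro x hx
    apply ContinuousOn.intervalIntegrable
    rw [uIcc_of_le hcd]
    intro y hy
    apply ContinuousAt.continuousWithinAt
    exact ContinuousAt.comp (g := F) (hF x hx y hy).continuousAt (by fun_prop)
  have ih : ∀ y ∈ Icc c d, IntervalIntegrable (fun x : ℝ => F (x + y * Complex.I))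
      MeasureTheory.volume a b := by
    intro y hy
    apply ContinuousOn.intervalIntegrable
    rw [uIcc_of_le hab]
    intro x hx
    apply ContinuousAt.continuousWithinAt
    exact ContinuousAt.comp (g := F) (hF x hx y hy).continuousAt (by fun_prop)
  have e1 := Complex.imCLM.intervalIntegral_comp_comm (ih c ⟨le_rfl, hcd⟩)
  have e2 := Complex.imCLM.intervalIntegral_comp_comm (ih d ⟨hcd, le_rfl⟩)
  have e3 := Complex.reCLM.intervalIntegral_comp_comm (iv a ⟨le_rfl, hab⟩)
  have e4 := Complex.reCLM.intervalIntegral_comp_comm (iv b ⟨hab, le_rfl⟩)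
  simp only [Complex.imCLM_apply, Complex.reCLM_apply] at e1 e2 e3 e4
  rw [e1, e2, e3, e4]
  have := congrArg Complex.im h
  simp at this
  linarith

lemma line_v {G : ℂ → ℂ} (hG : DifferentiableOn ℂ G LHP) {x : ℝ} (hx : x < 0) :
    Continuous (fun y : ℝ => G (x + y * Complex.I)) := by
  rw [continuous_iff_continuousAt]
  intro y
  exact ContinuousAt.comp (g := G)
    (hG.differentiableAt (isOpen_LHP.mem_nhds (mem_LHP hx))).continuousAt (by fun_prop)

lemma line_h {G : ℂ → ℂ} (hG : DifferentiableOn ℂ G LHP) {y : ℝ} :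
    ContinuousOn (fun x : ℝ => G (x + y * Complex.I)) (Iio 0) := by
  intro x hx
  apply ContinuousAt.continuousWithinAt
  exact ContinuousAt.comp (g := G)
    (hG.differentiableAt (isOpen_LHP.mem_nhds (mem_LHP hx))).continuousAt (by fun_prop)

lemma no_mid {G : ℂ → ℂ} (hG : DifferentiableOn ℂ G LHP)
    (hpos : ∀ z ∈ LHP, 0 < (deriv G z).re) {β : ℝ → ℝ}
    (hβ : ∀ t : ℝ, Tendsto (fun x : ℝ => (G (x + t * Complex.I)).im) (𝓝[<] 0) (𝓝 (β t)))
    {φ₁ φ₂ : ℝ} (hstrip : ∀ φ ∈ Ioo φ₁ φ₂, ∀ X : ℝ, (X + φ * Complex.I : ℂ) ∈ G '' LHP)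
    {s₀ s₁ : ℝ} (hs : s₀ < s₁) (h0 : φ₁ < β s₀) (h1 : β s₁ < φ₂) : False := by
  obtain ⟨a, ha1, ha2⟩ := exists_between h0
  obtain ⟨b, hb1, hb2⟩ := exists_between h1
  have ev := ((hβ s₀).eventually_const_lt ha2).and ((hβ s₁).eventually_lt_const hb1)
  obtain ⟨x₁, hx₁, hev⟩ := mem_nhdsLT_iff_exists_Ioo_subset.1 ev
  have hx₁' : x₁ < 0 := hx₁
  have hev' : ∀ x ∈ Ioo x₁ 0, a < (G (x + s₀ * Complex.I)).im ∧
      (G (x + s₁ * Complex.I)).im < b := fun x hx => hev hx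
  set x₀ := x₁ / 2 with hx₀
  have hx₀0 : x₀ < 0 := by simp only [hx₀]; linarith
  have hx₁₀ : x₁ < x₀ := by simp only [hx₀]; linarith
  have hmid : ∀ x ∈ Ico x₀ 0, ∀ y ∈ Icc s₀ s₁, (G (x + y * Complex.I)).im ∈ Icc a b := by
    intro x hx y hy
    have h := hev' x ⟨by linarith [hx.1], hx.2⟩
    exact ⟨h.1.le.trans (spiral_im_le hG hpos hx.2 hy.1),
      (spiral_im_le hG hpos hx.2 hy.2).trans h.2.le⟩
  have hab : a ≤ b := by
    have h := hmid x₀ ⟨le_rfl, hx₀0⟩ s₀ ⟨le_rfl, hs.le⟩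
    exact h.1.trans h.2
  set C := ∫ y in s₀..s₁, (G (x₀ + y * Complex.I)).re with hC
  set M := (C + (-x₀) * (b - a)) / (s₁ - s₀) + 1 with hM
  have hcomp : IsCompact ((fun φ : ℝ => (M + φ * Complex.I : ℂ)) '' Icc a b) :=
    isCompact_Icc.image (by fun_prop)
  set V : ℕ → Set ℂ := fun n => {z : ℂ | z.re < -1 / ((n : ℝ) + 1)} with hV
  have hVo : ∀ n, IsOpen (V n) := fun n => isOpen_lt Complex.continuous_re continuous_const
  have hVneg : ∀ n : ℕ, -1 / ((n : ℝ) + 1) < 0 := fun n =>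
    div_neg_of_neg_of_pos (by norm_num) (by positivity)
  have hVL : ∀ n, V n ⊆ LHP := by
    intro n z hz
    have h1 : z.re < -1 / ((n : ℝ) + 1) := hz
    exact h1.trans (hVneg n)
  have hVmono : Monotone V := by
    intro m n hmn z hz
    have h1 : z.re < -1 / ((m : ℝ) + 1) := hz
    have h2 : -1 / ((m : ℝ) + 1) ≤ -1 / ((n : ℝ) + 1) := by
      rw [neg_div, neg_div, neg_le_neg_iff]
      have : (m : ℝ) ≤ n := by exact_mod_cast hmn
      gcongr
    exact h1.trans_le h2
  obtain ⟨n, hn⟩ := hcomp.elim_directed_cover (fun n => G '' V n)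
    (fun n => spiral_open hG hpos (hVo n) (hVL n)) (by
      rintro _ ⟨φ, hφ, rfl⟩
      obtain ⟨z, hz, hze⟩ := hstrip φ ⟨ha1.trans_le hφ.1, hφ.2.trans_lt hb2⟩ M
      have hz' : 0 < -z.re := by
        have : z.re < 0 := hz
        linarith
      obtain ⟨n, hn⟩ := exists_nat_one_div_lt hz'
      refine mem_iUnion.2 ⟨n, z, ?_, hze⟩
      change z.re < -1 / ((n : ℝ) + 1)
      rw [neg_div]; linarith)
    (Monotone.directed_le (fun m n hmn => image_mono (hVmono hmn)))
  set x := max x₀ (-1 / ((n : ℝ) + 1)) with hx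
  have hx0 : x < 0 := max_lt hx₀0 (hVneg n)
  have hxx₀ : x₀ ≤ x := le_max_left _ _
  have hbig : ∀ y ∈ Icc s₀ s₁, M ≤ (G (x + y * Complex.I)).re := by
    intro y hy
    obtain ⟨z, hz, hze⟩ := hn ⟨_, hmid x ⟨hxx₀, hx0⟩ y hy, rfl⟩
    have hz1 : z.re < x := lt_of_lt_of_le hz (le_max_right _ _)
    have hne : z ≠ x + y * Complex.I := by
      rintro rfl; simp at hz1
    have := spiral_mono hG hpos (hVL n hz) (mem_LHP (y := y) hx0) hne
    simp only [hze] at this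
    simp at this
    nlinarith
  have hr := rect_im (F := G) hxx₀ hs.le (fun u hu y hy =>
    hG.differentiableAt (isOpen_LHP.mem_nhds (mem_LHP (lt_of_le_of_lt hu.2 hx0))))
  have hih : ∀ y : ℝ, IntervalIntegrable (fun u : ℝ => (G (u + y * Complex.I)).im)
      MeasureTheory.volume x₀ x := by
    intro y
    apply ContinuousOn.intervalIntegrable
    rw [uIcc_of_le hxx₀]
    exact (Complex.continuous_im.comp_continuousOn (line_h hG)).mono
      (fun u hu => lt_of_le_of_lt hu.2 hx0)
  have hL : M * (s₁ - s₀) ≤ ∫ y in s₀..s₁, (G (x + y * Complex.I)).re := by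
    have := intervalIntegral.integral_mono_on (μ := MeasureTheory.volume) hs.le (f := fun _ : ℝ => M)
      (g := fun y : ℝ => (G (x + y * Complex.I)).re) (continuous_const.intervalIntegrable _ _)
      ((Complex.continuous_re.comp (line_v hG hx0)).intervalIntegrable _ _) hbig
    simp at this
    linarith
  have hR : (∫ u in x₀..x, (G (u + s₁ * Complex.I)).im) -
      (∫ u in x₀..x, (G (u + s₀ * Complex.I)).im) ≤ (b - a) * (x - x₀) := by
    rw [← intervalIntegral.integral_sub (hih _) (hih _)]
    have := intervalIntegral.integral_mono_on (μ := MeasureTheory.volume) hxx₀ (g := fun _ => b - a)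
      ((hih s₁).sub (hih s₀)) (continuous_const.intervalIntegrable _ _) (by
        intro u hu
        have hu' : u ∈ Ico x₀ 0 := ⟨hu.1, lt_of_le_of_lt hu.2 hx0⟩
        have p1 := (hmid u hu' s₀ ⟨le_rfl, hs.le⟩).1
        have p2 := (hmid u hu' s₁ ⟨hs.le, le_rfl⟩).2
        linarith)
    simp only [intervalIntegral.integral_const, smul_eq_mul] at this
    linarith
  have hMe : M * (s₁ - s₀) = C + (-x₀) * (b - a) + (s₁ - s₀) := by
    have : s₁ - s₀ ≠ 0 := by linarith
    rw [hM]; field_simp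
  have : (b - a) * (x - x₀) ≤ (-x₀) * (b - a) := by nlinarith
  linarith

lemma halfdisc {G : ℂ → ℂ} (hG : DifferentiableOn ℂ G LHP)
    (hpos : ∀ z ∈ LHP, 0 < (deriv G z).re) {x θ m κ T : ℝ} (hx : x < 0) (hT : 0 ≤ T)
    (hκ : ∀ ρ : ℝ, Real.exp (-T) ≤ ρ → κ ≤ (G (x + (θ + ρ : ℝ) * Complex.I)).im
      - (G (x + (θ - ρ : ℝ) * Complex.I)).im)
    (hm : ∀ z ∈ LHP, ‖z - (x + θ * Complex.I)‖ = 1 → m ≤ (G z).re) :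
    Real.pi * m + κ * T ≤ Real.pi * ((G (x + θ * Complex.I)).re + 1) := by
  set c : ℂ := x + θ * Complex.I with hc
  have hcL : c ∈ LHP := mem_LHP hx
  have hcont : ∀ᶠ z in 𝓝 c, (G z).re < (G c).re + 1 := by
    have h1 : ContinuousAt (fun z => (G z).re) c :=
      Complex.continuous_re.continuousAt.comp
        (hG.differentiableAt (isOpen_LHP.mem_nhds hcL)).continuousAt
    exact h1.eventually_lt_const (by linarith)
  obtain ⟨δ, hδ, hball⟩ := Metric.eventually_nhds_iff.1 hcont
  set τ := min (-T) (Real.log (δ / 2)) with hτ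
  have hτT : τ ≤ -T := min_le_left _ _
  have hτ0 : τ ≤ 0 := by linarith
  have hτδ : Real.exp τ < δ := by
    have : Real.exp τ ≤ Real.exp (Real.log (δ / 2)) := Real.exp_le_exp.2 (min_le_right _ _)
    rw [Real.exp_log (by linarith)] at this
    linarith
  set F : ℂ → ℂ := fun s => G (c + Complex.exp s) with hF
  have hin : ∀ u : ℝ, ∀ ω ∈ Icc (Real.pi / 2) (3 * Real.pi / 2),
      c + Complex.exp (u + ω * Complex.I) ∈ LHP := by
    intro u ω hω
    change (c + Complex.exp (u + ω * Complex.I)).re < 0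
    have hcos : Real.cos ω ≤ 0 := Real.cos_nonpos_of_pi_div_two_le_of_le hω.1 (by linarith [hω.2])
    simp [hc, Complex.exp_re]
    nlinarith [Real.exp_pos u]
  have hdF : ∀ u : ℝ, ∀ ω ∈ Icc (Real.pi / 2) (3 * Real.pi / 2),
      DifferentiableAt ℂ F (u + ω * Complex.I) := by
    intro u ω hω
    have h1 := hG.differentiableAt (isOpen_LHP.mem_nhds (hin u ω hω))
    exact DifferentiableAt.comp (g := G) _ h1 (by fun_prop)
  have hpi := Real.pi_pos
  have hpi2 : Real.pi / 2 ≤ 3 * Real.pi / 2 := by linarith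
  have hr := rect_im (F := F) hτ0 hpi2 (fun u _ ω hω => hdF u ω hω)
  have hFv : ∀ u : ℝ, IntervalIntegrable (fun y : ℝ => (F (u + y * Complex.I)).re)
      MeasureTheory.volume (Real.pi / 2) (3 * Real.pi / 2) := by
    intro u
    apply ContinuousOn.intervalIntegrable
    rw [uIcc_of_le hpi2]
    intro y hy
    apply ContinuousAt.continuousWithinAt
    exact Complex.continuous_re.continuousAt.comp
      (ContinuousAt.comp (g := F) (hdF u y hy).continuousAt (by fun_prop))
  have htop : ∀ u : ℝ, F (u + (Real.pi / 2 : ℝ) * Complex.I)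
      = G (x + (θ + Real.exp u : ℝ) * Complex.I) := by
    intro u
    simp only [hF, hc]
    congr 1
    rw [Complex.exp_add]
    push_cast
    rw [Complex.exp_pi_div_two_mul_I]
    ring
  have hbot : ∀ u : ℝ, F (u + (3 * Real.pi / 2 : ℝ) * Complex.I)
      = G (x + (θ - Real.exp u : ℝ) * Complex.I) := by
    intro u
    simp only [hF, hc]
    congr 1
    have e : ((3 * Real.pi / 2 : ℝ) : ℂ) * Complex.I
        = Real.pi * Complex.I + Real.pi / 2 * Complex.I := by push_cast; ring
    rw [e, Complex.exp_add, Complex.exp_add, Complex.exp_pi_mul_I, Complex.exp_pi_div_two_mul_I]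
    push_cast
    ring
  simp only [htop, hbot] at hr
  have ct : Continuous (fun u : ℝ => (G (x + (θ + Real.exp u : ℝ) * Complex.I)).im) :=
    Complex.continuous_im.comp ((line_v hG hx).comp (by fun_prop :
      Continuous (fun u : ℝ => θ + Real.exp u)))
  have cb : Continuous (fun u : ℝ => (G (x + (θ - Real.exp u : ℝ) * Complex.I)).im) :=
    Complex.continuous_im.comp ((line_v hG hx).comp (by fun_prop :
      Continuous (fun u : ℝ => θ - Real.exp u)))
  -- lower bound on outer arc
  have b1 : Real.pi * m ≤ ∫ y in (Real.pi / 2)..(3 * Real.pi / 2),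
      (F ((0 : ℝ) + y * Complex.I)).re := by
    have := intervalIntegral.integral_mono_on (μ := MeasureTheory.volume) hpi2 (f := fun _ => m) (by simp) (hFv 0) (by
      intro y hy
      apply hm _ (hin 0 y hy)
      rw [add_sub_cancel_left]
      simp [Complex.norm_exp_ofReal_mul_I])
    rw [intervalIntegral.integral_const, smul_eq_mul] at this
    linarith
  -- upper bound on inner arc
  have b2 : (∫ y in (Real.pi / 2)..(3 * Real.pi / 2), (F (τ + y * Complex.I)).re)
      ≤ Real.pi * ((G c).re + 1) := by
    have := intervalIntegral.integral_mono_on (μ := MeasureTheory.volume) hpi2 (g := fun _ => (G c).re + 1) (hFv τ)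
      (by simp) (by
      intro y hy
      refine (hball ?_).le
      rw [dist_eq_norm, add_sub_cancel_left, Complex.norm_exp]
      simpa using hτδ)
    rw [intervalIntegral.integral_const, smul_eq_mul] at this
    linarith
  have b3 : κ * T ≤ ∫ u in τ..0, ((G (x + (θ + Real.exp u : ℝ) * Complex.I)).im
      - (G (x + (θ - Real.exp u : ℝ) * Complex.I)).im) := by
    have cd : Continuous (fun u : ℝ => (G (x + (θ + Real.exp u : ℝ) * Complex.I)).im
      - (G (x + (θ - Real.exp u : ℝ) * Complex.I)).im) := ct.sub cb
    rw [← intervalIntegral.integral_add_adjacent_intervals (b := -T)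
      (cd.intervalIntegrable _ _) (cd.intervalIntegrable _ _)]
    have p1 : 0 ≤ ∫ u in τ..(-T), ((G (x + (θ + Real.exp u : ℝ) * Complex.I)).im
      - (G (x + (θ - Real.exp u : ℝ) * Complex.I)).im) := by
      apply intervalIntegral.integral_nonneg hτT
      intro u _
      have := spiral_im_le hG hpos hx (y₁ := θ - Real.exp u) (y₂ := θ + Real.exp u)
        (by linarith [Real.exp_pos u])
      linarith
    have p2 := intervalIntegral.integral_mono_on (μ := MeasureTheory.volume) (neg_nonpos.2 hT) (f := fun _ : ℝ => κ)
      (continuous_const.intervalIntegrable _ _)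
      (cd.intervalIntegrable (-T) 0) (by
        intro u hu
        exact hκ _ (Real.exp_le_exp.2 hu.1))
    rw [intervalIntegral.integral_const, smul_eq_mul] at p2
    linarith
  rw [intervalIntegral.integral_sub (ct.intervalIntegrable _ _) (cb.intervalIntegrable _ _)] at b3
  linarith

lemma spiral_unbounded {G : ℂ → ℂ} (hG : DifferentiableOn ℂ G LHP)
    (hpos : ∀ z ∈ LHP, 0 < (deriv G z).re) {β : ℝ → ℝ} (hmono : Monotone β)
    (hβ : ∀ t : ℝ, Tendsto (fun x : ℝ => (G (x + t * Complex.I)).im) (𝓝[<] 0) (𝓝 (β t)))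
    {t₀ φ : ℝ} (h1 : leftLim β t₀ < φ) (h2 : φ < rightLim β t₀) (M : ℝ) :
    ∃ z ∈ LHP, (G z).im = φ ∧ M ≤ (G z).re := by
  obtain ⟨φm, hm1, hm2⟩ := exists_between h1
  obtain ⟨φp, hp1, hp2⟩ := exists_between h2
  have hκ : 0 < φp - φm := by linarith
  -- lower bound for Re G
  obtain ⟨m, hm⟩ : ∃ m : ℝ, ∀ y ∈ Icc (t₀ - 2) (t₀ + 2),
      m ≤ (G ((-2 : ℝ) + y * Complex.I)).re := by
    have hc := (Complex.continuous_re.comp (line_v hG (x := -2) (by norm_num)))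
    obtain ⟨m, hm⟩ := (isCompact_Icc (a := t₀ - 2) (b := t₀ + 2)).bddBelow_image hc.continuousOn
    exact ⟨m, fun y hy => hm ⟨y, hy, rfl⟩⟩
  set T := |Real.pi * (M + 1 - m)| / (φp - φm) with hT
  have hT0 : 0 ≤ T := by positivity
  set ρ := Real.exp (-T) with hρ
  have hρ0 : 0 < ρ := Real.exp_pos _
  have hρ1 : ρ ≤ 1 := Real.exp_le_one_iff.2 (by linarith)
  have l1 : β (t₀ - ρ / 2) < φm := (hmono.le_leftLim (by linarith)).trans_lt hm1
  have l2 : φp < β (t₀ + ρ / 2) := hp2.trans_le (hmono.rightLim_le (by linarith))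
  have ev := ((hβ _).eventually_lt_const l1).and ((hβ _).eventually_const_lt l2)
  have ev2 : ∀ᶠ x : ℝ in 𝓝[<] 0, x ∈ Ioo (-1 : ℝ) 0 := Ioo_mem_nhdsLT (by norm_num)
  obtain ⟨x, ⟨e1, e2⟩, hx1, hx0⟩ := (ev.and ev2).exists
  obtain ⟨θ, hθ, hθe⟩ := intermediate_value_Icc (by linarith : t₀ - ρ / 2 ≤ t₀ + ρ / 2)
    (Complex.continuous_im.comp (line_v hG hx0)).continuousOn
    (show φ ∈ Icc _ _ from ⟨(e1.trans hm2).le, (hp1.trans e2).le⟩)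
  have hθe' : (G (x + θ * Complex.I)).im = φ := hθe
  refine ⟨x + θ * Complex.I, mem_LHP hx0, hθe', ?_⟩
  have key := halfdisc hG hpos (x := x) (θ := θ) (m := m) (κ := φp - φm) (T := T) hx0 hT0 (by
      intro r hr
      have q1 := spiral_im_le hG hpos hx0 (y₁ := t₀ + ρ / 2) (y₂ := θ + r) (by linarith [hθ.1])
      have q2 := spiral_im_le hG hpos hx0 (y₁ := θ - r) (y₂ := t₀ - ρ / 2) (by linarith [hθ.2])
      linarith) (by
      intro z hz hz1
      have r1 := Complex.abs_re_le_norm (z - (x + θ * Complex.I))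
      have r2 := Complex.abs_im_le_norm (z - (x + θ * Complex.I))
      rw [hz1, abs_le] at r1 r2
      simp at r1 r2
      have hzr : z.re < 0 := hz
      have := spiral_re_le hG hpos (x₁ := -2) (x₂ := z.re) (y := z.im) hzr (by linarith)
      rw [Complex.re_add_im] at this
      exact (hm z.im ⟨by linarith [hθ.1], by linarith [hθ.2]⟩).trans this)
  have hTe : (φp - φm) * T = |Real.pi * (M + 1 - m)| := by
    rw [hT]; field_simp
  rw [hTe] at key
  have := le_abs_self (Real.pi * (M + 1 - m))
  have hpi := Real.pi_pos
  nlinarith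

/-- The logarithmic lift of `f`. -/
noncomputable def spLift (lam : ℝ) (L : ℂ → ℂ) (z : ℂ) : ℂ :=
  (1 - Real.tan lam * Complex.I) * (L (Complex.exp z) + z)

lemma exp_mem_ball {z : ℂ} (hz : z ∈ LHP) : Complex.exp z ∈ ball (0 : ℂ) 1 := by
  have h : z.re < 0 := hz
  rw [mem_ball_zero_iff, Complex.norm_exp]
  exact Real.exp_lt_one_iff.2 h

lemma spLift_hasDerivAt {lam : ℝ} {L : ℂ → ℂ} (hL : DifferentiableOn ℂ L (ball (0 : ℂ) 1))
    {z : ℂ} (hz : z ∈ LHP) :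
    HasDerivAt (spLift lam L) ((1 - Real.tan lam * Complex.I) *
      (deriv L (Complex.exp z) * Complex.exp z + 1)) z := by
  have h1 : HasDerivAt L (deriv L (Complex.exp z)) (Complex.exp z) :=
    (hL.differentiableAt (isOpen_ball.mem_nhds (exp_mem_ball hz))).hasDerivAt
  exact ((h1.comp z (Complex.hasDerivAt_exp z)).add (hasDerivAt_id z)).const_mul _

lemma spLift_diff {lam : ℝ} {L : ℂ → ℂ} (hL : DifferentiableOn ℂ L (ball (0 : ℂ) 1)) :
    DifferentiableOn ℂ (spLift lam L) LHP := fun _ hz =>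
  (spLift_hasDerivAt hL hz).differentiableAt.differentiableWithinAt

lemma f_eq {lam : ℝ} {f L : ℂ → ℂ} (hf : f ∈ SpiralClass lam) (hL : IsLogBranch f L)
    {z : ℂ} (hz : z ∈ ball (0 : ℂ) 1) : f z = z * Complex.exp (L z) := by
  by_cases h : z = 0
  · subst h; simp [hf.2.1]
  · rw [hL.2.2 z hz h]; field_simp

lemma spLift_pos {lam : ℝ} (hlam : lam ∈ Set.Ioo (-(Real.pi / 2)) (Real.pi / 2))
    {f L : ℂ → ℂ} (hf : f ∈ SpiralClass lam) (hL : IsLogBranch f L) :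
    ∀ z ∈ LHP, 0 < (deriv (spLift lam L) z).re := by
  intro z hz
  rw [(spLift_hasDerivAt hL.1 hz).deriv]
  set w := Complex.exp z with hw
  have hwb : w ∈ ball (0 : ℂ) 1 := exp_mem_ball hz
  have hw0 : w ≠ 0 := Complex.exp_ne_zero z
  have h := hf.2.2.2.2 w hwb hw0
  have hdL : HasDerivAt L (deriv L w) w :=
    (hL.1.differentiableAt (isOpen_ball.mem_nhds hwb)).hasDerivAt
  have hdf : deriv f w = Complex.exp (L w) + w * (Complex.exp (L w) * deriv L w) := by
    have he : f =ᶠ[𝓝 w] fun z => z * Complex.exp (L z) := by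
      filter_upwards [isOpen_ball.mem_nhds hwb] with y hy using f_eq hf hL hy
    rw [he.deriv_eq]
    have : HasDerivAt (fun z => z * Complex.exp (L z))
        (1 * Complex.exp (L w) + w * (Complex.exp (L w) * deriv L w)) w :=
      (hasDerivAt_id w).mul hdL.cexp
    rw [this.deriv, one_mul]
  have hcos : 0 < Real.cos lam := Real.cos_pos_of_mem_Ioo hlam
  have hcos' : (Real.cos lam : ℂ) ≠ 0 := by exact_mod_cast hcos.ne'
  have e1 : Complex.exp (-(lam : ℂ) * Complex.I)
      = Real.cos lam * (1 - Real.tan lam * Complex.I) := by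
    rw [Complex.exp_mul_I, Complex.cos_neg, Complex.sin_neg, Real.tan_eq_sin_div_cos]
    push_cast
    rw [← Complex.ofReal_cos, ← Complex.ofReal_sin]
    field_simp
    ring
  have e2 : Complex.exp (-(lam : ℂ) * Complex.I) * w * deriv f w / f w
      = Real.cos lam * ((1 - Real.tan lam * Complex.I) * (deriv L w * w + 1)) := by
    rw [e1, hdf, f_eq hf hL hwb]
    have := Complex.exp_ne_zero (L w)
    field_simp
    ring
  rw [e2, Complex.re_ofReal_mul] at h
  exact pos_of_mul_pos_right h hcos.le

lemma le_norm_c_mul (t : ℝ) (z : ℂ) : ‖z‖ ≤ ‖(1 - t * Complex.I) * z‖ := by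
  rw [norm_mul]
  have : 1 ≤ ‖(1 - t * Complex.I : ℂ)‖ := by
    have := Complex.abs_re_le_norm (1 - t * Complex.I : ℂ)
    simpa using this
  exact le_mul_of_one_le_left (norm_nonneg z) this

lemma spLift_prop {lam : ℝ} {L : ℂ → ℂ} (hL : DifferentiableOn ℂ L (ball (0 : ℂ) 1)) :
    ∀ x₀ < 0, ∃ C : ℝ, ∀ z : ℂ, z.re ≤ x₀ → ‖z‖ ≤ ‖spLift lam L z‖ + C := by
  intro x₀ hx₀
  obtain ⟨B, hB⟩ := (isCompact_closedBall (0 : ℂ) (Real.exp x₀)).exists_bound_of_continuousOn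
    (hL.continuousOn.mono (closedBall_subset_ball (Real.exp_lt_one_iff.2 hx₀)))
  refine ⟨‖(1 - Real.tan lam * Complex.I : ℂ)‖ * B, fun z hz => ?_⟩
  have h1 : ‖L (Complex.exp z)‖ ≤ B := by
    apply hB
    rw [mem_closedBall_zero_iff, Complex.norm_exp]
    exact Real.exp_le_exp.2 hz
  have h2 := le_norm_c_mul (Real.tan lam) z
  have e : (1 - Real.tan lam * Complex.I) * z = spLift lam L z
      - (1 - Real.tan lam * Complex.I) * L (Complex.exp z) := by
    unfold spLift; ring
  have h3 := norm_sub_le (spLift lam L z) ((1 - Real.tan lam * Complex.I) * L (Complex.exp z))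
  rw [← e, norm_mul (1 - Real.tan lam * Complex.I : ℂ) (L _)] at h3
  have h4 := mul_le_mul_of_nonneg_left h1 (norm_nonneg (1 - Real.tan lam * Complex.I : ℂ))
  linarith

lemma spLift_lim {lam : ℝ} {L : ℂ → ℂ} {β : ℝ → ℝ}
    (hβ : ∀ t : ℝ, Tendsto
        (fun r : ℝ => lambdaArgBranch lam L ((r : ℂ) * Complex.exp ((t : ℂ) * Complex.I)) + t)
        (𝓝[<] 1) (𝓝 (β t))) (t : ℝ) :
    Tendsto (fun x : ℝ => (spLift lam L (x + t * Complex.I)).im) (𝓝[<] 0) (𝓝 (β t)) := by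
  have h1 : Tendsto Real.exp (𝓝[<] 0) (𝓝[<] 1) := by
    apply tendsto_nhdsWithin_of_tendsto_nhds_of_eventually_within
    · have := Real.continuous_exp.tendsto 0
      rw [Real.exp_zero] at this
      exact this.mono_left nhdsWithin_le_nhds
    · filter_upwards [self_mem_nhdsWithin] with x hx
      exact Real.exp_lt_one_iff.2 hx
  have h2 := (hβ t).comp h1
  have h3 : Tendsto (fun x : ℝ => Real.tan lam * x) (𝓝[<] 0) (𝓝 0) := by
    have : Tendsto (fun x : ℝ => Real.tan lam * x) (𝓝 0) (𝓝 (Real.tan lam * 0)) :=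
      Continuous.tendsto (by fun_prop) 0
    rw [mul_zero] at this
    exact this.mono_left nhdsWithin_le_nhds
  have h4 := h2.sub h3
  rw [sub_zero] at h4
  refine h4.congr (fun x => ?_)
  simp only [comp, lambdaArgBranch, spLift]
  rw [Complex.exp_add, ← Complex.ofReal_exp]
  generalize Real.tan lam = T
  simp [Complex.mul_im]
  ring

lemma beta_period {lam : ℝ} {L : ℂ → ℂ} {β : ℝ → ℝ}
    (hβ : ∀ t : ℝ, Tendsto
        (fun r : ℝ => lambdaArgBranch lam L ((r : ℂ) * Complex.exp ((t : ℂ) * Complex.I)) + t)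
        (𝓝[<] 1) (𝓝 (β t))) (t : ℝ) : β (t + 2 * Real.pi) = β t + 2 * Real.pi := by
  have h1 := (hβ t).add_const (2 * Real.pi)
  refine tendsto_nhds_unique (hβ (t + 2 * Real.pi)) (h1.congr (fun r => ?_))
  have : Complex.exp (((t + 2 * Real.pi : ℝ) : ℂ) * Complex.I)
      = Complex.exp ((t : ℂ) * Complex.I) := by
    rw [Complex.exp_eq_exp_iff_exists_int]
    exact ⟨1, by push_cast; ring⟩
  rw [this]; ring

lemma mem_image_iff {lam : ℝ} {f L : ℂ → ℂ} (hf : f ∈ SpiralClass lam) (hL : IsLogBranch f L)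
    {R : ℝ} (hR : 0 < R) (ψ : ℝ) :
    (R : ℂ) * Complex.exp ((ψ : ℂ) * Complex.I) ∈ f '' ball (0 : ℂ) 1 ↔
      (((Real.log R + Real.tan lam * ψ : ℝ) : ℂ)
        + ((ψ - Real.tan lam * Real.log R : ℝ) : ℂ) * Complex.I) ∈ spLift lam L '' LHP := by
  have hRe : (R : ℂ) * Complex.exp ((ψ : ℂ) * Complex.I)
      = Complex.exp (Real.log R + ψ * Complex.I) := by
    rw [Complex.exp_add, ← Complex.ofReal_exp, Real.exp_log hR]
  have hc : (((Real.log R + Real.tan lam * ψ : ℝ) : ℂ)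
        + ((ψ - Real.tan lam * Real.log R : ℝ) : ℂ) * Complex.I)
      = (1 - Real.tan lam * Complex.I) * (Real.log R + ψ * Complex.I) := by
    generalize Real.tan lam = T
    push_cast
    linear_combination (T : ℂ) * ψ * Complex.I_sq
  have hc0 : (1 - Real.tan lam * Complex.I : ℂ) ≠ 0 := by
    intro h; have := congrArg Complex.re h; simp at this
  rw [hRe, hc]
  constructor
  · rintro ⟨z, hz, hfz⟩
    have hz0 : z ≠ 0 := by
      rintro rfl
      rw [hf.2.1] at hfz
      exact Complex.exp_ne_zero _ hfz.symm
    rw [f_eq hf hL hz, ← Complex.exp_log hz0, ← Complex.exp_add,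
      Complex.exp_eq_exp_iff_exists_int, Complex.exp_log hz0] at hfz
    obtain ⟨n, hn⟩ := hfz
    have hexp : Complex.exp (Complex.log z - n * (2 * Real.pi * Complex.I)) = z := by
      rw [Complex.exp_sub, Complex.exp_log hz0, Complex.exp_int_mul_two_pi_mul_I, div_one]
    refine ⟨Complex.log z - n * (2 * Real.pi * Complex.I), ?_, ?_⟩
    · rw [mem_ball_zero_iff, ← hexp, Complex.norm_exp, Real.exp_lt_one_iff] at hz
      exact hz
    · unfold spLift
      rw [hexp]
      congr 1
      linear_combination hn
  · rintro ⟨z, hz, hze⟩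
    refine ⟨Complex.exp z, exp_mem_ball hz, ?_⟩
    rw [f_eq hf hL (exp_mem_ball hz), ← Complex.exp_add]
    congr 1
    have := mul_left_cancel₀ hc0 hze
    rw [← this]; ring

/-- for `f ∈ F_λ`, the quantity `A(f) = lim_{R→∞} α(R, f)` is the maximum
of the jumps `β_λ(t+,f) − β_λ(t−,f)`; in particular this maximum is attained. -/
theorem arc_limit_eq_max_jump (lam : ℝ)
    (hlam : lam ∈ Set.Ioo (-(Real.pi / 2)) (Real.pi / 2))
    (f : ℂ → ℂ) (hf : f ∈ SpiralClass lam) (L : ℂ → ℂ) (hL : IsLogBranch f L)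
    (β : ℝ → ℝ) (hmono : Monotone β)
    (hβ : ∀ t : ℝ, Tendsto
        (fun r : ℝ => lambdaArgBranch lam L ((r : ℂ) * Complex.exp ((t : ℂ) * Complex.I)) + t)
        (𝓝[<] 1) (𝓝 (β t)))
    (Af : ℝ) (hAf : Tendsto (arcLength f) atTop (𝓝 Af)) :
    IsGreatest {j : ℝ | ∃ t : ℝ, j = Function.rightLim β t - Function.leftLim β t} Af := by
  have hG := spLift_diff (lam := lam) hL.1
  have hpos := spLift_pos hlam hf hL
  have hprop := spLift_prop (lam := lam) hL.1
  have hb := spLift_lim hβ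
  have hper := beta_period hβ
  have hpi := Real.pi_pos
  set G := spLift lam L with hGdef
  -- set defining arcLength
  set S : ℝ → Set ℝ := fun R => {a : ℝ | 0 ≤ a ∧ a ≤ 2 * Real.pi ∧ ∃ θ₀ : ℝ, ∀ ψ : ℝ,
    |ψ - θ₀| < a / 2 → (R : ℂ) * Complex.exp ((ψ : ℂ) * Complex.I) ∈ f '' ball (0 : ℂ) 1} with hS
  have hSe : ∀ R, arcLength f R = sSup (S R) := fun R => rfl
  have hSb : ∀ R, BddAbove (S R) := fun R => ⟨2 * Real.pi, fun a ha => ha.2.1⟩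
  have hS0 : ∀ R, (0 : ℝ) ∈ S R := fun R =>
    ⟨le_rfl, by linarith, 0, fun ψ h => by
      have := abs_nonneg (ψ - 0)
      exfalso; linarith⟩
  -- the limit dominates all the jumps
  have hge : ∀ t, rightLim β t - leftLim β t ≤ Af := by
    intro t
    have hJ0 : leftLim β t ≤ rightLim β t := hmono.leftLim_le_rightLim le_rfl
    have hJ1 : rightLim β t - leftLim β t ≤ 2 * Real.pi := by
      have a1 : rightLim β t ≤ β (t + Real.pi) := hmono.rightLim_le (by linarith)
      have a2 : β (t - Real.pi) ≤ leftLim β t := hmono.le_leftLim (by linarith)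
      have a3 := hper (t - Real.pi)
      rw [show t - Real.pi + 2 * Real.pi = t + Real.pi by ring] at a3
      linarith
    refine ge_of_tendsto hAf ?_
    filter_upwards [eventually_gt_atTop 0] with R hR
    rw [hSe]
    apply le_csSup (hSb R)
    refine ⟨by linarith, hJ1,
      (rightLim β t + leftLim β t) / 2 + Real.tan lam * Real.log R, fun ψ hψ => ?_⟩
    rw [mem_image_iff hf hL hR]
    rw [abs_lt] at hψ
    obtain ⟨z, hz, hzi, hzr⟩ := spiral_unbounded hG hpos hmono hb (t₀ := t)
      (φ := ψ - Real.tan lam * Real.log R) (by linarith [hψ.1]) (by linarith [hψ.2])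
      (Real.log R + Real.tan lam * ψ)
    have h := spiral_trans hG hpos hprop (mem_image_of_mem G hz)
      (S := (G z).re - (Real.log R + Real.tan lam * ψ)) (by linarith)
    convert h using 1
    apply Complex.ext
    · simp
    · simp [hzi, -Complex.ofReal_tan]
  have hAf0 : 0 ≤ Af := by
    have h1 := hge 0
    have h2 : leftLim β 0 ≤ rightLim β 0 := hmono.leftLim_le_rightLim le_rfl
    linarith
  refine ⟨?_, fun j hj => by obtain ⟨t, rfl⟩ := hj; exact hge t⟩
  rcases hAf0.eq_or_lt with h0 | hApos
  · refine ⟨0, le_antisymm ?_ (hge 0)⟩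
    have h2 : leftLim β 0 ≤ rightLim β 0 := hmono.leftLim_le_rightLim le_rfl
    linarith
  -- a full strip in the image
  obtain ⟨φs, hstrip⟩ : ∃ φs : ℝ, ∀ φ ∈ Ioo (φs - Af / 2) (φs + Af / 2), ∀ X : ℝ,
      (X + φ * Complex.I : ℂ) ∈ G '' LHP := by
    have hex : ∀ n : ℕ, ∃ a : ℝ, ∃ c ∈ Icc (0 : ℝ) (2 * Real.pi),
        arcLength f ((n : ℝ) + 1) - 1 / ((n : ℝ) + 1) < a ∧ ∀ φ : ℝ, |φ - c| < a / 2 →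
        ((Real.log ((n : ℝ) + 1) + Real.tan lam * (φ + Real.tan lam * Real.log ((n : ℝ) + 1)) : ℝ)
          + φ * Complex.I : ℂ) ∈ G '' LHP := by
      intro n
      have hn : (0 : ℝ) < (n : ℝ) + 1 := by positivity
      obtain ⟨a, ⟨ha0, ha1, θ₀, hθ⟩, halt⟩ := exists_lt_of_lt_csSup ⟨0, hS0 ((n : ℝ) + 1)⟩
        (show arcLength f ((n : ℝ) + 1) - 1 / ((n : ℝ) + 1) < sSup (S ((n : ℝ) + 1)) by
          rw [← hSe]; have : 0 < 1 / ((n : ℝ) + 1) := by positivity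
          linarith)
      set q := θ₀ - Real.tan lam * Real.log ((n : ℝ) + 1) with hq
      have h2pi : 0 < 2 * Real.pi := by positivity
      refine ⟨a, toIcoMod h2pi 0 q, ?_, halt, fun φ hφ => ?_⟩
      · have := toIcoMod_mem_Ico h2pi 0 q
        rw [zero_add] at this
        exact Ico_subset_Icc_self this
      · have hmod : toIcoMod h2pi 0 q = q - toIcoDiv h2pi 0 q * (2 * Real.pi) := by
          have := self_sub_toIcoDiv_zsmul h2pi 0 q
          rw [← this]; simp
        set k := toIcoDiv h2pi 0 q with hk
        rw [hmod] at hφ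
        have h1 := hθ (φ + Real.tan lam * Real.log ((n : ℝ) + 1) + k * (2 * Real.pi)) (by
          convert hφ using 2
          rw [hq]; ring)
        have h2 : Complex.exp (((φ + Real.tan lam * Real.log ((n : ℝ) + 1)
            + k * (2 * Real.pi) : ℝ) : ℂ) * Complex.I)
            = Complex.exp (((φ + Real.tan lam * Real.log ((n : ℝ) + 1) : ℝ) : ℂ) * Complex.I) := by
          rw [Complex.exp_eq_exp_iff_exists_int]
          exact ⟨k, by push_cast; ring⟩
        rw [h2, mem_image_iff hf hL hn] at h1
        convert h1 using 4
        ring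
    choose a c hc ha hφ using hex
    obtain ⟨φs, -, u, hu, hlim⟩ := isCompact_Icc.tendsto_subseq hc
    refine ⟨φs, fun φ hφs X => ?_⟩
    have hcast : Tendsto (fun n : ℕ => (n : ℝ) + 1) atTop atTop :=
      tendsto_atTop_add_const_right _ _ tendsto_natCast_atTop_atTop
    have t1 : Tendsto (fun n : ℕ => (arcLength f ((n : ℝ) + 1) - 1 / ((n : ℝ) + 1)) / 2)
        atTop (𝓝 (Af / 2)) := by
      have := ((hAf.comp hcast).sub tendsto_one_div_add_atTop_nhds_zero_nat).div_const 2
      simpa using this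
    have t2 : Tendsto (fun n : ℕ => Real.log ((n : ℝ) + 1)) atTop atTop :=
      Real.tendsto_log_atTop.comp hcast
    have t3 : Tendsto (fun n => |φ - c (u n)|) atTop (𝓝 |φ - φs|) :=
      (tendsto_const_nhds.sub hlim).abs
    have hlt : |φ - φs| < Af / 2 := by
      rw [abs_lt]; exact ⟨by linarith [hφs.1], by linarith [hφs.2]⟩
    have e1 := t3.eventually_lt (t1.comp hu.tendsto_atTop) hlt
    have e2 := (t2.comp hu.tendsto_atTop).eventually_ge_atTop (|X - Real.tan lam * φ|)
    obtain ⟨n, h1, h2⟩ := (e1.and e2).exists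
    simp only [comp] at h1 h2
    have h3 := hφ (u n) φ (h1.trans (by linarith [ha (u n)]))
    have h4 := spiral_trans hG hpos hprop h3
      (S := Real.log ((u n : ℝ) + 1)
        + Real.tan lam * (φ + Real.tan lam * Real.log ((u n : ℝ) + 1)) - X) (by
        have := le_abs_self (X - Real.tan lam * φ)
        have h5 := abs_nonneg (X - Real.tan lam * φ)
        nlinarith [mul_nonneg (sq_nonneg (Real.tan lam)) (h5.trans h2)])
    convert h4 using 1
    push_cast
    ring
  have hno : ∀ s₀ s₁ : ℝ, s₀ < s₁ → φs - Af / 2 < β s₀ → β s₁ < φs + Af / 2 → False :=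
    fun s₀ s₁ h h1 h2 => no_mid hG hpos hb hstrip h h1 h2
  -- locate the jump
  have hlow : ∃ t, β t ≤ φs := by
    have hk : ∀ n : ℕ, β (-(n * (2 * Real.pi))) = β 0 - n * (2 * Real.pi) := by
      intro n
      induction n with
      | zero => simp
      | succ n ih =>
        have := hper (-((n + 1 : ℕ) * (2 * Real.pi)))
        rw [show -((n + 1 : ℕ) * (2 * Real.pi)) + 2 * Real.pi = -(n * (2 * Real.pi)) by
          push_cast; ring, ih] at this
        push_cast at *
        linarith
    obtain ⟨n, hn⟩ := exists_nat_ge ((β 0 - φs) / (2 * Real.pi))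
    rw [div_le_iff₀ (by positivity)] at hn
    exact ⟨_, by rw [hk n]; linarith⟩
  have hhigh : ∃ t, φs < β t := by
    have hk : ∀ n : ℕ, β (n * (2 * Real.pi)) = β 0 + n * (2 * Real.pi) := by
      intro n
      induction n with
      | zero => simp
      | succ n ih =>
        have := hper (n * (2 * Real.pi))
        rw [ih] at this
        push_cast
        rw [show ((n : ℝ) + 1) * (2 * Real.pi) = n * (2 * Real.pi) + 2 * Real.pi by ring]
        linarith
    obtain ⟨n, hn⟩ := exists_nat_gt ((φs - β 0) / (2 * Real.pi))
    rw [div_lt_iff₀ (by positivity)] at hn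
    exact ⟨_, by rw [hk n]; linarith⟩
  obtain ⟨tl, htl⟩ := hlow
  obtain ⟨th, hth⟩ := hhigh
  set t₀ := sSup {t | β t ≤ φs} with ht₀
  have hbdd : BddAbove {t | β t ≤ φs} := ⟨th, fun t ht => by
    by_contra! hlt
    have h1 : β t ≤ φs := ht
    linarith [hmono hlt.le]⟩
  have hbelow : ∀ t < t₀, β t ≤ φs := by
    intro t ht
    obtain ⟨s, hs, hts⟩ := exists_lt_of_lt_csSup ⟨tl, htl⟩ ht
    exact (hmono hts.le).trans hs
  have habove : ∀ t, t₀ < t → φs < β t := by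
    intro t ht
    by_contra! hle
    exact absurd (le_csSup hbdd hle) (not_le.2 ht)
  have hR : φs + Af / 2 ≤ rightLim β t₀ := by
    refine ge_of_tendsto (hmono.tendsto_rightLim t₀) ?_
    filter_upwards [self_mem_nhdsWithin] with t ht
    have ht' : t₀ < t := ht
    by_contra! hlt
    exact hno ((t₀ + t) / 2) t (by linarith)
      (by linarith [habove ((t₀ + t) / 2) (by linarith)]) hlt
  have hL' : leftLim β t₀ ≤ φs - Af / 2 := by
    refine le_of_tendsto (hmono.tendsto_leftLim t₀) ?_
    filter_upwards [self_mem_nhdsWithin] with t ht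
    have ht' : t < t₀ := ht
    by_contra! hlt
    exact hno t ((t₀ + t) / 2) (by linarith) hlt
      (by linarith [hbelow ((t₀ + t) / 2) (by linarith)])
  exact ⟨t₀, le_antisymm (by linarith) (hge t₀)⟩
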